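/- Let P be a finite poset with |P| elements, let q ∈ ℚ[X] be a strict order polynomial of P and p ∈ ℚ[X] an order polynomial of P. Then the coefficient of X in q equals (−1)^{|P|−1} times the coefficient of X in p. -/

import Mathlib

/-- Number of order-preserving maps `P → Fin n`. -/
noncomputable def orderCount (P : Type*) [PartialOrder P] (n : ℕ) : ℕ :=
  Nat.card {f : P → Fin n // Monotone f}

/-- Number of strictly order-preserving maps `P → Fin n`. -/
noncomputable def strictCount (P : Type*) [PartialOrder P] (n : ℕ) : ℕ :=
  Nat.card {f : P → Fin n // StrictMono f}

/-- `p` is an order polynomial of `P`. -/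
def IsOrderPoly (P : Type*) [PartialOrder P] (p : Polynomial ℚ) : Prop :=
  ∀ n : ℕ, 0 < n → p.eval (n : ℚ) = orderCount P n

/-- `q` is a strict order polynomial of `P`. -/
def IsStrictOrderPoly (P : Type*) [PartialOrder P] (q : Polynomial ℚ) : Prop :=
  ∀ n : ℕ, 0 < n → q.eval (n : ℚ) = strictCount P n

open Finset Matrix

namespace OrderPoly

/-! ### Powers of a unipotent matrix -/

section Unipotent

variable {ι : Type*} [Fintype ι] [DecidableEq ι]

/-- The binomial series `∑ k < d, choose x k • N ^ k`, truncated at `d`. -/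
noncomputable def binomialSeries (N : Matrix ι ι ℚ) (d : ℕ) (x : ℚ) : Matrix ι ι ℚ :=
  ∑ k ∈ range d, Ring.choose x k • N ^ k

lemma binomialSeries_zero (N : Matrix ι ι ℚ) (d : ℕ) : binomialSeries N (d + 1) 0 = 1 := by
  simp [binomialSeries, sum_range_succ']

lemma binomialSeries_add_one {N : Matrix ι ι ℚ} {d : ℕ} (hN : N ^ (d + 1) = 0) (x : ℚ) :
    binomialSeries N (d + 1) (x + 1) = binomialSeries N (d + 1) x * (1 + N) := by
  have h : binomialSeries N (d + 1) x * N = ∑ k ∈ range d, Ring.choose x k • N ^ (k + 1) := by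
    rw [binomialSeries, sum_mul, sum_range_succ]
    simp [← pow_succ, hN]
  rw [mul_add, mul_one, h, binomialSeries, binomialSeries, sum_range_succ', sum_range_succ' _ d]
  simp only [Ring.choose_succ_succ, add_smul, sum_add_distrib, Ring.choose_zero_right]
  abel

lemma binomialSeries_natCast {N : Matrix ι ι ℚ} {d : ℕ} (hN : N ^ (d + 1) = 0) (n : ℕ) :
    binomialSeries N (d + 1) n = (1 + N) ^ n := by
  induction n with
  | zero => simpa using binomialSeries_zero N d
  | succ n ih => rw [Nat.cast_succ, binomialSeries_add_one hN, ih, pow_succ]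

lemma binomialSeries_neg_natCast {N M : Matrix ι ι ℚ} {d : ℕ} (hN : N ^ (d + 1) = 0)
    (hM : (1 + N) * M = 1) (n : ℕ) : binomialSeries N (d + 1) (-n) = M ^ n := by
  induction n with
  | zero => simpa using binomialSeries_zero N d
  | succ n ih =>
    have h := binomialSeries_add_one hN (-((n + 1 : ℕ) : ℚ))
    rw [show -((n + 1 : ℕ) : ℚ) + 1 = -n by push_cast; ring, ih] at h
    rw [pow_succ, h, mul_assoc, hM, mul_one]

lemma exists_polynomial_eval_eq_binomialSeries (N : Matrix ι ι ℚ) (d : ℕ) (i j : ι) :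
    ∃ b : Polynomial ℚ, ∀ x, b.eval x = binomialSeries N d x i j := by
  refine ⟨∑ k ∈ range d, Polynomial.C ((k.factorial : ℚ)⁻¹ * (N ^ k) i j) *
    (descPochhammer ℤ k).map (Int.castRingHom ℚ), fun x => ?_⟩
  simp only [binomialSeries, Matrix.sum_apply, Matrix.smul_apply, Polynomial.eval_finsetSum]
  refine sum_congr rfl fun k _ => ?_
  rw [Ring.choose_eq_smul, Polynomial.eval_mul, Polynomial.eval_C, Polynomial.eval_map,
    Polynomial.eval₂_eq_sum, Polynomial.smeval_eq_sum, Polynomial.sum, Polynomial.sum]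
  simp only [Polynomial.smul_pow, smul_eq_mul, zsmul_eq_mul, eq_intCast]
  ring

end Unipotent

lemma eq_of_eval_natCast_eq {p q : Polynomial ℚ}
    (h : ∀ n : ℕ, 0 < n → p.eval (n : ℚ) = q.eval (n : ℚ)) : p = q := by
  refine Polynomial.eq_of_infinite_eval_eq p q ?_
  refine Set.infinite_of_injective_forall_mem (f := fun n : ℕ => ((n + 1 : ℕ) : ℚ))
    (fun a b hab => ?_) fun n => h (n + 1) n.succ_pos
  simpa using hab

/-! ### Signs and toggling -/

section Toggle

variable {P : Type*} [DecidableEq P]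

/-- The diagonal matrix with entries `(-1) ^ |I|`. -/
def signMatrix (P : Type*) [DecidableEq P] : Matrix (Finset P) (Finset P) ℚ :=
  Matrix.diagonal fun I => (-1) ^ #I

lemma signMatrix_mul_self [Fintype P] : signMatrix P * signMatrix P = 1 := by
  simp [signMatrix, Matrix.diagonal_mul_diagonal, ← mul_pow]

/-- Adds `x` to a finset not containing it and removes it otherwise. -/
def toggle (x : P) (K : Finset P) : Finset P := if x ∈ K then K.erase x else insert x K

lemma toggle_toggle (x : P) (K : Finset P) : toggle x (toggle x K) = K := by
  by_cases h : x ∈ K <;> simp [toggle, h]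

lemma mem_toggle (x y : P) (K : Finset P) :
    y ∈ toggle x K ↔ (y = x ∧ x ∉ K) ∨ (y ≠ x ∧ y ∈ K) := by
  unfold toggle; split_ifs <;> grind

lemma neg_one_pow_card_toggle (x : P) (K : Finset P) :
    (-1 : ℚ) ^ #(toggle x K) = - (-1) ^ #K := by
  by_cases h : x ∈ K
  · rw [toggle, if_pos h, ← card_erase_add_one h, pow_succ]; ring
  · rw [toggle, if_neg h, card_insert_of_notMem h, pow_succ]; ring

end Toggle

/-! ### Transfer matrices -/

section Transfer

variable {P : Type*} [PartialOrder P]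

open Classical in
/-- The transfer matrix on the subsets of `P`: the entry at `(I, J)` is `1` if `I ⊆ J` and every
element below an element of `J \ I` lies in `I` or, when `s` holds, in `J`; it is `0` otherwise. -/
noncomputable def transfer (P : Type*) [PartialOrder P] (s : Prop) :
    Matrix (Finset P) (Finset P) ℚ := fun I J =>
  if I ⊆ J ∧ ∀ a b, a < b → b ∈ J → b ∉ I → a ∈ I ∨ (s ∧ a ∈ J) then 1 else 0

lemma transfer_self (s : Prop) (I : Finset P) : transfer P s I I = 1 :=
  if_pos ⟨Subset.rfl, fun _ _ _ h h' => absurd h h'⟩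

lemma transfer_eq_zero {s : Prop} {I J : Finset P} (h : ¬ I ⊆ J) : transfer P s I J = 0 :=
  if_neg fun h' => h h'.1

variable [Fintype P] [DecidableEq P]

lemma transfer_sub_one_pow_eq_zero_of_card_lt (s : Prop) (k : ℕ) (I J : Finset P)
    (h : #J < #I + k) : ((transfer P s - 1) ^ k) I J = 0 := by
  induction k generalizing J with
  | zero => rw [pow_zero, Matrix.one_apply_ne]; rintro rfl; omega
  | succ k ih =>
    rw [pow_succ, Matrix.mul_apply]
    refine sum_eq_zero fun K _ => ?_
    by_cases hK : #K < #I + k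
    · rw [ih K hK, zero_mul]
    · rw [Matrix.sub_apply]
      obtain rfl | hKJ := eq_or_ne K J
      · rw [transfer_self, Matrix.one_apply_eq, sub_self, mul_zero]
      · rw [transfer_eq_zero, Matrix.one_apply_ne hKJ, sub_self, mul_zero]
        exact fun h' => hKJ (eq_of_subset_of_card_le h' (by omega))

lemma transfer_sub_one_pow_eq_zero (s : Prop) :
    (transfer P s - 1) ^ (Fintype.card P + 1) = 0 := by
  ext I J
  exact transfer_sub_one_pow_eq_zero_of_card_lt s _ I J (by have := card_le_univ J; omega)

lemma transfer_mul_transfer_toggle {I J : Finset P} {x : P} (hxJ : x ∈ J) (hxI : x ∉ I)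
    (hx : ∀ y ∈ J, y ∉ I → ¬ y < x) {K : Finset P}
    (hK : transfer P False I K * transfer P True K J ≠ 0) :
    transfer P False I (toggle x K) * transfer P True (toggle x K) J = 1 := by
  unfold transfer at hK ⊢
  rw [ite_mul, zero_mul, one_mul] at hK
  split_ifs at hK with h₁ h₂ <;> try exact absurd rfl hK
  obtain ⟨hIK, h₁⟩ := h₁
  obtain ⟨hKJ, h₂⟩ := h₂
  have below : ∀ a, a < x → a ∈ I := by
    intro a ha
    by_cases hxK : x ∈ K
    · simpa using h₁ a x ha hxK hxI
    · by_contra haI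
      rcases h₂ a x ha hxJ hxK with h | h
      · exact hx a (hKJ h) haI ha
      · exact hx a h.2 haI ha
  rw [if_pos, if_pos, one_mul]
  · refine ⟨fun y hy => ?_, fun a b hab hb hbK => Or.inr ⟨trivial, ?_⟩⟩
    · rw [mem_toggle] at hy
      grind
    · rw [mem_toggle] at hbK
      by_cases hbx : b = x
      · subst hbx; exact hKJ (hIK (below a hab))
      · have := h₂ a b hab hb (by tauto)
        rcases this with h | h
        exacts [hKJ h, h.2]
  · refine ⟨fun y hy => ?_, fun a b hab hb hbI => Or.inl ?_⟩
    · rw [mem_toggle]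
      exact Or.inr ⟨fun h => hxI (h ▸ hy), hIK hy⟩
    · rw [mem_toggle] at hb
      rcases hb with ⟨rfl, -⟩ | ⟨-, hb⟩
      exacts [below a hab, by simpa using h₁ a b hab hb hbI]

lemma sum_transfer_mul_transfer {I J : Finset P} (h : I ≠ J) :
    ∑ K, (-1) ^ #K * (transfer P False I K * transfer P True K J) = 0 := by
  by_cases hIJ : I ⊆ J
  · obtain ⟨x, hx⟩ := (J \ I).exists_minimal
      (sdiff_nonempty.2 fun h' => h (Subset.antisymm hIJ h'))
    have hxJ := (mem_sdiff.1 hx.1).1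
    have hxI := (mem_sdiff.1 hx.1).2
    have hmin : ∀ y ∈ J, y ∉ I → ¬ y < x := fun y hy hyI hyx =>
      hx.not_lt (mem_sdiff.2 ⟨hy, hyI⟩) hyx
    have key : ∀ K, transfer P False I (toggle x K) * transfer P True (toggle x K) J =
        transfer P False I K * transfer P True K J := by
      intro K
      have h₁ := transfer_mul_transfer_toggle hxJ hxI hmin (K := K)
      have h₂ := transfer_mul_transfer_toggle hxJ hxI hmin (K := toggle x K)
      rw [toggle_toggle] at h₂
      by_cases h₀ : transfer P False I (toggle x K) * transfer P True (toggle x K) J = 0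
      · by_contra h'
        rw [h₁ fun h => h' (h₀.trans h.symm)] at h₀
        exact one_ne_zero h₀
      · rw [h₂ h₀, h₁]
        rw [h₂ h₀]
        exact one_ne_zero
    refine sum_ninvolution (toggle x) (fun K => ?_) (fun K _ hK => ?_) (fun _ => mem_univ _)
      (toggle_toggle x)
    · rw [key, neg_one_pow_card_toggle]; ring
    · have := mem_toggle x x K
      rw [hK] at this
      tauto
  · refine sum_eq_zero fun K _ => ?_
    by_cases hIK : I ⊆ K
    · rw [transfer_eq_zero (I := K) fun h' => hIJ (hIK.trans h'), mul_zero, mul_zero]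
    · rw [transfer_eq_zero hIK, zero_mul, mul_zero]

lemma signed_transfer_mul_transfer :
    signMatrix P * transfer P False * signMatrix P * transfer P True = 1 := by
  ext I J
  have h : (signMatrix P * transfer P False * signMatrix P * transfer P True) I J =
      (-1) ^ #I * ∑ K, (-1) ^ #K * (transfer P False I K * transfer P True K J) := by
    rw [Matrix.mul_apply, mul_sum]
    refine sum_congr rfl fun K _ => ?_
    rw [signMatrix, Matrix.mul_diagonal, Matrix.diagonal_mul]
    ring
  rw [h]
  obtain rfl | hIJ := eq_or_ne I J
  · rw [Matrix.one_apply_eq, sum_eq_single I]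
    · rw [transfer_self, transfer_self, mul_one, mul_one, ← mul_pow]; simp
    · intro K _ hK
      by_cases hIK : I ⊆ K
      · rw [transfer_eq_zero (I := K) fun h' => hK (Subset.antisymm h' hIK), mul_zero, mul_zero]
      · rw [transfer_eq_zero hIK, zero_mul, mul_zero]
    · simp
  · rw [sum_transfer_mul_transfer hIJ, mul_zero, Matrix.one_apply_ne hIJ]

lemma signed_transfer_pow (s : Prop) (n : ℕ) :
    (signMatrix P * transfer P s * signMatrix P) ^ n =
      signMatrix P * transfer P s ^ n * signMatrix P := by
  induction n with
  | zero => rw [pow_zero, pow_zero, mul_one, signMatrix_mul_self]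
  | succ n ih =>
    calc _ = signMatrix P * transfer P s ^ n * (signMatrix P * signMatrix P) *
          transfer P s * signMatrix P := by rw [pow_succ, ih]; simp only [mul_assoc]
      _ = _ := by rw [signMatrix_mul_self, mul_one, pow_succ]; simp only [mul_assoc]

/-! ### Counting maps -/

open Classical in
/-- The maps `P → {0, …, n}` taking a value less than `n` exactly on `J`, and which on `J` are
strictly order-preserving or, when `s` holds, order-preserving. -/
noncomputable def mapsOn (s : Prop) (n : ℕ) (J : Finset P) : Finset (P → ℕ) :=
  (Fintype.piFinset fun _ => range (n + 1)).filter fun f =>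
    (∀ x, f x < n ↔ x ∈ J) ∧ ∀ a b, a < b → f b < n → f a < f b ∨ (s ∧ f a = f b)

lemma mem_mapsOn {s : Prop} {n : ℕ} {J : Finset P} {f : P → ℕ} :
    f ∈ mapsOn s n J ↔ (∀ x, f x ≤ n) ∧ (∀ x, f x < n ↔ x ∈ J) ∧
      ∀ a b, a < b → f b < n → f a < f b ∨ (s ∧ f a = f b) := by
  simp [mapsOn, Fintype.mem_piFinset]

lemma card_mapsOn_zero (s : Prop) (J : Finset P) :
    (#(mapsOn s 0 J) : ℚ) = (1 : Matrix (Finset P) (Finset P) ℚ) ∅ J := by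
  obtain rfl | hJ := eq_or_ne ∅ J
  · have : mapsOn s 0 (∅ : Finset P) = {0} := by
      ext f
      simp [mem_mapsOn, funext_iff]
    simp [this]
  · rw [Matrix.one_apply_ne hJ, Nat.cast_eq_zero, card_eq_zero, eq_empty_iff_forall_notMem]
    intro f hf
    refine hJ (eq_empty_iff_forall_notMem.2 fun x hx => ?_).symm
    simpa using ((mem_mapsOn.1 hf).2.1 x).2 hx

lemma card_mapsOn_fiber (s : Prop) (n : ℕ) (I J : Finset P) :
    (#{f ∈ mapsOn s (n + 1) J | univ.filter (fun x => f x < n) = I} : ℚ) =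
      #(mapsOn s n I) * transfer P s I J := by
  unfold transfer
  split_ifs with h
  · obtain ⟨hIJ, h⟩ := h
    rw [mul_one, Nat.cast_inj]
    refine card_nbij' (fun f x => min (f x) n) (fun g x => if x ∈ J then g x else n + 1)
      ?_ ?_ ?_ ?_
    · intro f hf
      simp only [coe_filter, mem_mapsOn, Set.mem_ofPred_eq, mem_coe] at hf ⊢
      obtain ⟨⟨h₁, h₂, h₃⟩, rfl⟩ := hf
      refine ⟨fun x => min_le_right _ _, fun x => by simp, fun a b hab hb => ?_⟩
      have hb' : f b < n := by simpa using hb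
      have := h₃ a b hab (by omega)
      rcases this with h | ⟨h, h'⟩
      · left; omega
      · right; exact ⟨h, by omega⟩
    · intro g hg
      simp only [coe_filter, mem_mapsOn, Set.mem_ofPred_eq, mem_coe] at hg ⊢
      obtain ⟨h₁, h₂, h₃⟩ := hg
      refine ⟨⟨fun x => ?_, fun x => ?_, fun a b hab hb => ?_⟩, ?_⟩
      · have := h₁ x; split_ifs <;> omega
      · have := h₁ x; split_ifs with hx <;> simp [hx]; omega
      · have hbJ : b ∈ J := by by_contra hbJ; simp [hbJ] at hb
        rw [if_pos hbJ]
        by_cases hbI : b ∈ I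
        · have hgb := (h₂ b).2 hbI
          have h₄ := h₃ a b hab hgb
          have haJ : a ∈ J := hIJ ((h₂ a).1 (by omega))
          rwa [if_pos haJ]
        · have hgb : g b = n := le_antisymm (h₁ b) (not_lt.1 fun h' => hbI ((h₂ b).1 h'))
          rcases h a b hab hbJ hbI with haI | ⟨hs, haJ⟩
          · rw [if_pos (hIJ haI), hgb]
            exact Or.inl ((h₂ a).2 haI)
          · rw [if_pos haJ, hgb]
            exact (h₁ a).lt_or_eq.imp_right fun h' => ⟨hs, h'⟩
      · ext x
        have := h₂ x
        have := @hIJ x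
        simp only [mem_filter, mem_univ, true_and]
        split_ifs with hx
        · assumption
        · constructor
          · intro; omega
          · tauto
    · intro f hf
      simp only [coe_filter, mem_mapsOn, Set.mem_ofPred_eq] at hf
      obtain ⟨⟨h₁, h₂, h₃⟩, rfl⟩ := hf
      ext x
      have := h₁ x
      have := h₂ x
      dsimp only
      split_ifs with hx
      · have := this.2 hx; omega
      · have := mt this.1 hx; omega
    · intro g hg
      simp only [mem_mapsOn, mem_coe] at hg
      obtain ⟨h₁, h₂, h₃⟩ := hg
      ext x
      have := h₁ x
      have := h₂ x
      have := @hIJ x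
      dsimp only
      split_ifs with hx
      · omega
      · have : ¬ g x < n := by tauto
        omega
  · rw [mul_zero, Nat.cast_eq_zero, card_eq_zero, eq_empty_iff_forall_notMem]
    intro f hf
    rw [mem_filter, mem_mapsOn] at hf
    obtain ⟨⟨h₁, h₂, h₃⟩, rfl⟩ := hf
    refine h ⟨fun x hx => (h₂ x).1 ?_, fun a b hab hbJ hbI => ?_⟩
    · have := (mem_filter.1 hx).2
      omega
    · have hb := (h₂ b).2 hbJ
      simp only [mem_filter, mem_univ, true_and] at hbI ⊢
      rcases h₃ a b hab hb with h | ⟨hs, h⟩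
      · left; omega
      · exact Or.inr ⟨hs, (h₂ a).1 (by omega)⟩

lemma card_mapsOn (s : Prop) (n : ℕ) (J : Finset P) :
    (#(mapsOn s n J) : ℚ) = (transfer P s ^ n) ∅ J := by
  induction n generalizing J with
  | zero => rw [card_mapsOn_zero, pow_zero]
  | succ n ih =>
    rw [pow_succ, Matrix.mul_apply, card_eq_sum_card_fiberwise
      (f := fun f => univ.filter fun x => f x < n) (t := univ) (fun _ _ => by simp), Nat.cast_sum]
    exact sum_congr rfl fun I _ => by rw [card_mapsOn_fiber, ih]

lemma natCard_maps (s : Prop) (n : ℕ) :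
    (Nat.card {f : P → Fin n // ∀ a b, a < b → f a < f b ∨ (s ∧ f a = f b)} : ℚ) =
      (transfer P s ^ n) ∅ univ := by
  rw [← card_mapsOn, ← Nat.card_eq_finsetCard, Nat.cast_inj]
  exact Nat.card_congr
    { toFun f := ⟨fun x => f.1 x, mem_mapsOn.2 ⟨fun x => (f.1 x).2.le, fun x => by simp,
        fun a b hab _ => by simpa [Fin.ext_iff] using f.2 a b hab⟩⟩
      invFun g := ⟨fun x => ⟨g.1 x, ((mem_mapsOn.1 g.2).2.1 x).2 (mem_univ x)⟩, fun a b hab => by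
        simpa [Fin.ext_iff] using
          (mem_mapsOn.1 g.2).2.2 a b hab (((mem_mapsOn.1 g.2).2.1 b).2 (mem_univ b))⟩
      left_inv _ := rfl
      right_inv _ := rfl }

lemma orderCount_eq (n : ℕ) : (orderCount P n : ℚ) = (transfer P True ^ n) ∅ univ := by
  rw [← natCard_maps, orderCount]
  congr! 4 with f
  simp only [true_and, ← le_iff_lt_or_eq]
  exact monotone_iff_forall_lt.trans ⟨fun h a b => @h a b, fun h a b => h a b⟩

lemma strictCount_eq (n : ℕ) : (strictCount P n : ℚ) = (transfer P False ^ n) ∅ univ := by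
  rw [← natCard_maps, strictCount]
  congr! 4 with f
  simp only [false_and, or_false]
  exact ⟨fun h a b => @h a b, fun h a b => h a b⟩

end Transfer

/-- Reciprocity for order polynomials. -/
theorem strictOrderPoly_eq {P : Type*} [Fintype P] [PartialOrder P] {q p : Polynomial ℚ}
    (hq : IsStrictOrderPoly P q) (hp : IsOrderPoly P p) :
    q = Polynomial.C ((-1) ^ Fintype.card P) * p.comp (-Polynomial.X) := by
  classical
  have hN := transfer_sub_one_pow_eq_zero (P := P) True
  have hM : (1 + (transfer P True - 1)) * (signMatrix P * transfer P False * signMatrix P) = 1 := by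
    rw [add_sub_cancel, _root_.mul_eq_one_comm]
    exact signed_transfer_mul_transfer
  obtain ⟨b, hb⟩ := exists_polynomial_eval_eq_binomialSeries (transfer P True - 1)
    (Fintype.card P + 1) ∅ univ
  have hpb : p = b := eq_of_eval_natCast_eq fun n hn => by
    rw [hp n hn, hb, binomialSeries_natCast hN, add_sub_cancel, orderCount_eq]
  subst hpb
  refine eq_of_eval_natCast_eq fun n hn => ?_
  rw [hq n hn, Polynomial.eval_mul, Polynomial.eval_C, Polynomial.eval_comp, Polynomial.eval_neg,
    Polynomial.eval_X, hb, binomialSeries_neg_natCast hN hM, signed_transfer_pow, strictCount_eq,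
    signMatrix, Matrix.mul_diagonal, Matrix.diagonal_mul, card_empty, pow_zero, one_mul, card_univ,
    mul_left_comm, ← mul_pow]
  simp

end OrderPoly

/-- The coefficient of `X` in the strict order polynomial equals
`(−1)^{|P|−1}` times the coefficient of `X` in the order polynomial. -/
theorem strictOrderPoly_coeff_one (P : Type*) [Fintype P] [PartialOrder P]
    (q p : Polynomial ℚ) (hq : IsStrictOrderPoly P q) (hp : IsOrderPoly P p) :
    q.coeff 1 = (-1 : ℚ) ^ (Fintype.card P - 1) * p.coeff 1 := by
  obtain hP | hP := isEmpty_or_nonempty P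
  · have : q = p := OrderPoly.eq_of_eval_natCast_eq fun n hn => by
      rw [hq n hn, hp n hn, orderCount, strictCount]
      simp [Monotone, StrictMono]
    simp [this]
  · rw [OrderPoly.strictOrderPoly_eq hq hp, Polynomial.coeff_C_mul,
      show -Polynomial.X = Polynomial.C (-1 : ℚ) * Polynomial.X by simp,
      Polynomial.comp_C_mul_X_coeff]
    obtain ⟨m, hm⟩ := Nat.exists_eq_succ_of_ne_zero (Fintype.card_ne_zero (α := P))
    rw [hm, Nat.succ_sub_one, pow_succ]
    ring
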